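/- arXiv:2207.14270 — 2 statements merged into one kernel-verified Lean document; each statement's English description precedes it below -/
import Mathlib

section
/- Let f, g, f', g' ∈ R be nonzero Ore polynomials such that f'f = g'g. Then f'f is a least common left multiple of f and g (i.e. lclm(f,g) = f'f up to a left unit) if and only if gcld(f', g') = 1. The analogous statement for least common right multiples and greatest common right divisors also holds: if f f' = g g', then f f' is a least common right multiple of f and g if and only if gcrd(f', g') = 1. -/
/-- `δ` is a `σ`-derivation of the field `L`. -/
def IsSigmaDerivation {L : Type*} [Field L] (σ : L ≃+* L) (δ : L → L) : Prop :=
  (∀ a b : L, δ (a + b) = δ a + δ b) ∧ ∀ a b : L, δ (a * b) = σ a * δ b + δ a * b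

/-- The ring `R`, together with the embedding of constants `C : L →+* R` and the
element `X`, is the Ore extension `L[x;σ,δ]`: the twisting rule
`X * C a = C (σ a) * X + C (δ a)` holds and every element of `R` is, in a unique way,
a left `L`-linear combination of the powers of `X`. -/
structure IsOreExtension {L : Type*} [Field L] (σ : L ≃+* L) (δ : L → L)
    (R : Type*) [Ring R] (C : L →+* R) (X : R) : Prop where
  twist : ∀ a : L, X * C a = C (σ a) * X + C (δ a)
  repr_unique : ∀ r : R, ∃! f : ℕ →₀ L, r = f.sum fun n a => C a * X ^ n

/-- The degree of an Ore polynomial (`⊥` for the zero polynomial). -/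
noncomputable def IsOreExtension.deg {L : Type*} [Field L] {σ : L ≃+* L} {δ : L → L}
    {R : Type*} [Ring R] {C : L →+* R} {X : R}
    (H : IsOreExtension σ δ R C X) (r : R) : WithBot ℕ :=
  (H.repr_unique r).exists.choose.support.max

/-- `f` is a right divisor of `g` : `g = u * f` for some `u`. -/
def RDvd {R : Type*} [Ring R] (f g : R) : Prop := ∃ u, g = u * f

/-- `f` is a left divisor of `g` : `g = f * u` for some `u`. -/
def LDvd {R : Type*} [Ring R] (f g : R) : Prop := ∃ u, g = f * u

/-- `m` is a least common left multiple of the family `f`. -/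
def IsLclm {R : Type*} [Ring R] {ι : Type*} (f : ι → R) (m : R) : Prop :=
  (∀ i, RDvd (f i) m) ∧ ∀ m' : R, (∀ i, RDvd (f i) m') → RDvd m m'

/-- `m` is a least common right multiple of the family `f`. -/
def IsLcrm {R : Type*} [Ring R] {ι : Type*} (f : ι → R) (m : R) : Prop :=
  (∀ i, LDvd (f i) m) ∧ ∀ m' : R, (∀ i, LDvd (f i) m') → LDvd m m'

/-- `gcld (f, g) = 1`, i.e. `fR + gR = R`. -/
def LCoprime {R : Type*} [Ring R] (f g : R) : Prop := ∃ a b : R, f * a + g * b = 1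

/-- `gcrd (f, g) = 1`, i.e. `Rf + Rg = R`. -/
def RCoprime {R : Type*} [Ring R] (f g : R) : Prop := ∃ a b : R, a * f + b * g = 1

namespace IsOreExtension

variable {L : Type*} [Field L] {σ : L ≃+* L} {δ : L → L} {R : Type*} [Ring R] {C : L →+* R} {X : R}

/-- The additive map sending a coefficient sequence to the corresponding Ore polynomial. -/
noncomputable def ofCoeff (C : L →+* R) (X : R) : (ℕ →₀ L) →+ R :=
  Finsupp.liftAddHom fun n => (AddMonoidHom.mulRight (X ^ n)).comp C.toAddMonoidHom

theorem ofCoeff_apply (p : ℕ →₀ L) : ofCoeff C X p = p.sum fun n a => C a * X ^ n := by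
  simp [ofCoeff, Finsupp.sum]

theorem ofCoeff_bijective (H : IsOreExtension σ δ R C X) :
    Function.Bijective (ofCoeff C X) := by
  rw [Function.bijective_iff_existsUnique]
  intro r
  simpa only [ofCoeff_apply, eq_comm] using H.repr_unique r

/-- The coefficients of an Ore polynomial. -/
noncomputable def coeff (H : IsOreExtension σ δ R C X) : R ≃+ (ℕ →₀ L) :=
  (AddEquiv.ofBijective (ofCoeff C X) H.ofCoeff_bijective).symm

theorem coeff_monomial (H : IsOreExtension σ δ R C X) (n : ℕ) (a : L) :
    H.coeff (C a * X ^ n) = Finsupp.single n a := by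
  rw [coeff, AddEquiv.symm_apply_eq]
  simp [ofCoeff_apply]

theorem sum_coeff (H : IsOreExtension σ δ R C X) (r : R) :
    ((H.coeff r).sum fun n a => C a * X ^ n) = r := by
  rw [← ofCoeff_apply]
  exact (AddEquiv.ofBijective (ofCoeff C X) H.ofCoeff_bijective).apply_symm_apply r

theorem induction_on (H : IsOreExtension σ δ R C X) {p : R → Prop} (r : R) (zero : p 0)
    (add : ∀ r s, p r → p s → p (r + s)) (monomial : ∀ n a, p (C a * X ^ n)) : p r := by
  rw [← H.sum_coeff r]
  exact Finset.sum_induction _ p add zero fun n _ => monomial n _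

theorem coeff_C_mul (H : IsOreExtension σ δ R C X) (a : L) (r : R) (i : ℕ) :
    H.coeff (C a * r) i = a * H.coeff r i := by
  induction r using H.induction_on with
  | zero => simp
  | add r s hr hs => simp [mul_add, hr, hs]
  | monomial n b =>
    rw [← mul_assoc, ← map_mul, coeff_monomial, coeff_monomial]
    simp only [Finsupp.single_apply, mul_ite, mul_zero]

theorem coeff_X_mul_succ (H : IsOreExtension σ δ R C X) (hδ : IsSigmaDerivation σ δ)
    (r : R) (i : ℕ) :
    H.coeff (X * r) (i + 1) = σ (H.coeff r i) + δ (H.coeff r (i + 1)) := by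
  have h0 : δ 0 = 0 := by simpa using hδ.1 0 0
  induction r using H.induction_on with
  | zero => simp [h0]
  | add r s hr hs => simp only [mul_add, map_add, Finsupp.add_apply, hr, hs, hδ.1]; ring
  | monomial n b =>
    rw [← mul_assoc, H.twist, add_mul, mul_assoc, ← pow_succ', map_add H.coeff, Finsupp.add_apply]
    simp only [coeff_monomial, Finsupp.single_apply, add_left_inj]
    split_ifs <;> simp [h0]

theorem coeff_X_pow_mul (H : IsOreExtension σ δ R C X) (hδ : IsSigmaDerivation σ δ)
    {s : R} {m : ℕ} (hs : ∀ i, m < i → H.coeff s i = 0) (n : ℕ) :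
    (∀ i, n + m < i → H.coeff (X ^ n * s) i = 0) ∧
      H.coeff (X ^ n * s) (n + m) = σ^[n] (H.coeff s m) := by
  have h0 : δ 0 = 0 := by simpa using hδ.1 0 0
  induction n with
  | zero => simpa using hs
  | succ n ih =>
    rw [pow_succ', mul_assoc]
    constructor
    · rintro (_ | i) hi
      · omega
      · rw [H.coeff_X_mul_succ hδ, ih.1 i (by omega), ih.1 (i + 1) (by omega), h0, map_zero,
          add_zero]
    · rw [add_right_comm, H.coeff_X_mul_succ hδ, ih.1 (n + m + 1) (by omega), ih.2, h0, add_zero,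
        Function.iterate_succ_apply']

theorem coeff_mul (H : IsOreExtension σ δ R C X) (r s : R) (i : ℕ) :
    H.coeff (r * s) i = (H.coeff r).sum fun n a => a * H.coeff (X ^ n * s) i := by
  conv_lhs => rw [← H.sum_coeff r]
  simp only [Finsupp.sum, Finset.sum_mul, map_sum, Finsupp.finsetSum_apply, mul_assoc, coeff_C_mul]

theorem coeff_mul_eq_zero (H : IsOreExtension σ δ R C X) (hδ : IsSigmaDerivation σ δ)
    {r s : R} {n m : ℕ} (hr : ∀ i, n < i → H.coeff r i = 0) (hs : ∀ i, m < i → H.coeff s i = 0)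
    {i : ℕ} (hi : n + m < i) : H.coeff (r * s) i = 0 := by
  rw [coeff_mul]
  refine Finset.sum_eq_zero fun k hk => ?_
  have hkn : k ≤ n := by
    by_contra h
    exact Finsupp.mem_support_iff.mp hk (hr k (by omega))
  beta_reduce
  rw [(H.coeff_X_pow_mul hδ hs k).1 i (by omega), mul_zero]

theorem coeff_mul_add (H : IsOreExtension σ δ R C X) (hδ : IsSigmaDerivation σ δ)
    {r s : R} {n m : ℕ} (hr : ∀ i, n < i → H.coeff r i = 0) (hs : ∀ i, m < i → H.coeff s i = 0) :
    H.coeff (r * s) (n + m) = H.coeff r n * σ^[n] (H.coeff s m) := by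
  rw [coeff_mul, Finsupp.sum, Finset.sum_eq_single n]
  · rw [(H.coeff_X_pow_mul hδ hs n).2]
  · intro k hk hkn
    have hkn' : k ≤ n := by
      by_contra h
      exact Finsupp.mem_support_iff.mp hk (hr k (by omega))
    rw [(H.coeff_X_pow_mul hδ hs k).1 (n + m) (by omega), mul_zero]
  · intro hn
    rw [Finsupp.notMem_support_iff.mp hn, zero_mul]

/-- The degree of an Ore polynomial as a natural number (`0` for the zero polynomial). -/
noncomputable def natDeg (H : IsOreExtension σ δ R C X) (r : R) : ℕ :=
  (H.coeff r).support.sup id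

theorem coeff_eq_zero_of_natDeg_lt (H : IsOreExtension σ δ R C X) (r : R) (i : ℕ)
    (hi : H.natDeg r < i) : H.coeff r i = 0 := by
  by_contra h
  exact hi.not_ge (Finset.le_sup (f := id) (Finsupp.mem_support_iff.mpr h))

theorem coeff_natDeg_ne_zero (H : IsOreExtension σ δ R C X) {r : R} (hr : r ≠ 0) :
    H.coeff r (H.natDeg r) ≠ 0 := by
  have hne : (H.coeff r).support.Nonempty := by
    rw [Finsupp.support_nonempty_iff]
    simpa using hr
  obtain ⟨i, hi, h⟩ := Finset.exists_mem_eq_sup _ hne id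
  rw [natDeg, h]
  exact Finsupp.mem_support_iff.mp hi

theorem noZeroDivisors (H : IsOreExtension σ δ R C X) (hδ : IsSigmaDerivation σ δ) :
    NoZeroDivisors R where
  eq_zero_or_eq_zero_of_mul_eq_zero {r s} h := by
    by_contra! hrs
    have key := H.coeff_mul_add hδ (H.coeff_eq_zero_of_natDeg_lt r)
      (H.coeff_eq_zero_of_natDeg_lt s)
    rw [h, map_zero, Finsupp.zero_apply, eq_comm, mul_eq_zero] at key
    refine key.elim (H.coeff_natDeg_ne_zero hrs.1) fun hσ => H.coeff_natDeg_ne_zero hrs.2 ?_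
    exact σ.injective.iterate _ (by rw [hσ, iterate_map_zero])

theorem exists_sub_natDeg_lt (H : IsOreExtension σ δ R C X) (J : AddSubgroup R) (d : ℕ)
    (hJ : ∀ n, d ≤ n → ∀ a, ∃ u ∈ J, (∀ i, n < i → H.coeff u i = 0) ∧ H.coeff u n = a) (r : R) :
    ∃ u ∈ J, r - u = 0 ∨ H.natDeg (r - u) < d := by
  suffices h : ∀ n (r : R), (∀ i, n ≤ i → H.coeff r i = 0) →
      ∃ u ∈ J, r - u = 0 ∨ H.natDeg (r - u) < d from
    h (H.natDeg r + 1) r fun i hi => H.coeff_eq_zero_of_natDeg_lt r i hi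
  have small : ∀ n ≤ d, ∀ r : R, (∀ i, n ≤ i → H.coeff r i = 0) →
      ∃ u ∈ J, r - u = 0 ∨ H.natDeg (r - u) < d := by
    refine fun n hn r hr => ⟨0, J.zero_mem, ?_⟩
    rw [sub_zero]
    by_contra! h
    exact H.coeff_natDeg_ne_zero h.1 (hr _ (hn.trans h.2))
  intro n
  induction n with
  | zero => exact small 0 d.zero_le
  | succ n ih =>
    intro r hr
    rcases Nat.lt_or_ge n d with hn | hn
    · exact small (n + 1) hn r hr
    · obtain ⟨u, huJ, hu, hun⟩ := hJ n hn (H.coeff r n)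
      obtain ⟨v, hvJ, hv⟩ := ih (r - u) fun i hi => by
        rw [map_sub, Finsupp.sub_apply]
        rcases hi.eq_or_lt with rfl | hi
        · rw [hun, sub_self]
        · rw [hr i hi, hu i hi, sub_self]
      exact ⟨u + v, J.add_mem huJ hvJ, by rwa [← sub_sub]⟩

theorem coeff_monomial_eq_zero (H : IsOreExtension σ δ R C X) (n : ℕ) (a : L) (i : ℕ)
    (hi : n < i) : H.coeff (C a * X ^ n) i = 0 := by
  rw [coeff_monomial, Finsupp.single_eq_of_ne hi.ne']

theorem exists_sub_mul_natDeg_lt (H : IsOreExtension σ δ R C X) (hδ : IsSigmaDerivation σ δ)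
    (r : R) {g : R} (hg : g ≠ 0) : ∃ q, r - q * g = 0 ∨ H.natDeg (r - q * g) < H.natDeg g := by
  obtain ⟨_, ⟨q, rfl⟩, h⟩ := H.exists_sub_natDeg_lt (AddMonoidHom.mulRight g).range (H.natDeg g)
    (fun n hn a => by
      obtain ⟨k, rfl⟩ := Nat.exists_eq_add_of_le' hn
      have hne : σ^[k] (H.coeff g (H.natDeg g)) ≠ 0 := fun h =>
        H.coeff_natDeg_ne_zero hg (σ.injective.iterate k (by rw [h, iterate_map_zero]))
      have hg' := H.coeff_eq_zero_of_natDeg_lt g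
      have hm := H.coeff_monomial_eq_zero k (a / σ^[k] (H.coeff g (H.natDeg g)))
      refine ⟨_, ⟨_, rfl⟩, fun i hi => H.coeff_mul_eq_zero hδ hm hg' hi, ?_⟩
      exact (H.coeff_mul_add hδ hm hg').trans (by simp [coeff_monomial, hne])) r
  exact ⟨q, h⟩

theorem exists_sub_mul_natDeg_lt' (H : IsOreExtension σ δ R C X) (hδ : IsSigmaDerivation σ δ)
    (r : R) {g : R} (hg : g ≠ 0) : ∃ q, r - g * q = 0 ∨ H.natDeg (r - g * q) < H.natDeg g := by
  obtain ⟨_, ⟨q, rfl⟩, h⟩ := H.exists_sub_natDeg_lt (AddMonoidHom.mulLeft g).range (H.natDeg g)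
    (fun n hn a => by
      obtain ⟨k, rfl⟩ := Nat.exists_eq_add_of_le hn
      obtain ⟨c, hc⟩ := σ.surjective.iterate (H.natDeg g) (a / H.coeff g (H.natDeg g))
      have hg' := H.coeff_eq_zero_of_natDeg_lt g
      have hm := H.coeff_monomial_eq_zero k c
      refine ⟨_, ⟨C c * X ^ k, rfl⟩, fun i hi => H.coeff_mul_eq_zero hδ hg' hm hi, ?_⟩
      refine (H.coeff_mul_add hδ hg' hm).trans ?_
      rw [coeff_monomial, Finsupp.single_eq_same, hc, mul_div_cancel₀ _ (H.coeff_natDeg_ne_zero hg)])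
    r
  exact ⟨q, h⟩

end IsOreExtension

/-- A ring with a left Euclidean division has only principal left ideals. -/
theorem isPrincipalIdealRing_of_exists_sub_mul_lt {R : Type*} [Ring R] (d : R → ℕ)
    (hd : ∀ r g : R, g ≠ 0 → ∃ q, r - q * g = 0 ∨ d (r - q * g) < d g) :
    IsPrincipalIdealRing R where
  principal I := by
    by_cases hI : ∃ g ∈ I, g ≠ 0
    · obtain ⟨g, ⟨hgI, hg⟩, hmin⟩ :=
        (measure d).wf.has_min {g | g ∈ I ∧ g ≠ 0} hI
      refine ⟨g, le_antisymm (fun r hr => ?_) ((Ideal.span_singleton_le_iff_mem I).mpr hgI)⟩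
      obtain ⟨q, hq⟩ := hd r g hg
      have hzero : r - q * g = 0 := by
        by_contra hne
        exact hmin _ ⟨I.sub_mem hr (I.mul_mem_left q hgI), hne⟩ (hq.resolve_left hne)
      exact Submodule.mem_span_singleton.mpr ⟨q, (sub_eq_zero.mp hzero).symm⟩
    · push Not at hI
      exact ⟨0, by simpa [Submodule.eq_bot_iff] using hI⟩

open MulOpposite in
theorem isLclm_iff_lCoprime {R : Type*} [Ring R] [IsDomain R] [IsPrincipalIdealRing R]
    [IsPrincipalIdealRing Rᵐᵒᵖ] {f g f' g' : R} (hf : f ≠ 0) (hf' : f' ≠ 0)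
    (h : f' * f = g' * g) : IsLclm ![f, g] (f' * f) ↔ LCoprime f' g' := by
  constructor
  · rintro ⟨-, hmin⟩
    obtain ⟨d, hd⟩ := IsPrincipalIdealRing.principal (Ideal.span {op f', op g'})
    have hdvd : ∀ r ∈ ({op f', op g'} : Set Rᵐᵒᵖ), ∃ p, p * d = r := fun r hr =>
      Submodule.mem_span_singleton.mp (hd ▸ Ideal.subset_span hr)
    obtain ⟨p, hp⟩ := hdvd (op f') (by simp)
    obtain ⟨q, hq⟩ := hdvd (op g') (by simp)
    obtain ⟨a, b, hab⟩ := Ideal.mem_span_pair.mp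
      (hd ▸ Submodule.mem_span_singleton_self d : d ∈ Ideal.span {op f', op g'})
    replace hp : unop d * unop p = f' := congrArg unop hp
    replace hq : unop d * unop q = g' := congrArg unop hq
    replace hab : f' * unop a + g' * unop b = unop d := congrArg unop hab
    have hd0 : unop d ≠ 0 := left_ne_zero_of_mul (hp.trans_ne hf')
    have hp0 : unop p ≠ 0 := right_ne_zero_of_mul (hp.trans_ne hf')
    have hpq : unop p * f = unop q * g := mul_left_cancel₀ hd0 <| by
      rw [← mul_assoc, ← mul_assoc, hp, hq, h]
    obtain ⟨w, hw⟩ := hmin (unop p * f) <| by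
      simpa [Fin.forall_fin_two] using ⟨⟨unop p, rfl⟩, ⟨unop q, hpq⟩⟩
    have hwd : w * unop d = 1 := mul_right_cancel₀ (mul_ne_zero hp0 hf) <| by
      rw [one_mul, mul_assoc, ← mul_assoc (unop d), hp, ← hw]
    refine ⟨unop a * w, unop b * w, ?_⟩
    rw [← mul_assoc, ← mul_assoc, ← add_mul, hab, mul_eq_one_symm hwd]
  · rintro ⟨a, b, hab⟩
    refine ⟨by simpa [Fin.forall_fin_two] using ⟨⟨f', rfl⟩, ⟨g', h⟩⟩, fun m' hm' => ?_⟩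
    obtain ⟨⟨u, hu⟩, ⟨v, hv⟩⟩ : RDvd f m' ∧ RDvd g m' := by simpa [Fin.forall_fin_two] using hm'
    have hg : g ≠ 0 := right_ne_zero_of_mul (h ▸ mul_ne_zero hf' hf)
    obtain ⟨m, hm⟩ := IsPrincipalIdealRing.principal (Ideal.span {f} ⊓ Ideal.span {g})
    have hmem : ∀ r, (∃ u, u * f = r) → (∃ v, v * g = r) → ∃ w, w * m = r := fun r h₁ h₂ =>
      Submodule.mem_span_singleton.mp
        (hm ▸ ⟨Ideal.mem_span_singleton'.mpr h₁, Ideal.mem_span_singleton'.mpr h₂⟩)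
    have hself : m ∈ Ideal.span {f} ⊓ Ideal.span {g} :=
      hm ▸ Submodule.mem_span_singleton_self m
    obtain ⟨p, hp⟩ := Ideal.mem_span_singleton'.mp hself.1
    obtain ⟨q, hq⟩ := Ideal.mem_span_singleton'.mp hself.2
    obtain ⟨d, hd⟩ := hmem (f' * f) ⟨f', rfl⟩ ⟨g', h.symm⟩
    obtain ⟨w, hw⟩ := hmem m' ⟨u, hu.symm⟩ ⟨v, hv.symm⟩
    have hdp : d * p = f' := mul_right_cancel₀ hf <| by rw [mul_assoc, hp, hd]
    have hdq : d * q = g' := mul_right_cancel₀ hg <| by rw [mul_assoc, hq, hd, h]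
    have hd1 : d * (p * a + q * b) = 1 := by
      rw [mul_add, ← mul_assoc, ← mul_assoc, hdp, hdq, hab]
    refine ⟨w * (p * a + q * b), ?_⟩
    rw [← hd, mul_assoc, ← mul_assoc _ d, mul_eq_one_symm hd1, one_mul, hw]

open MulOpposite in
theorem isLclm_op_iff {R : Type*} [Ring R] {f g m : R} :
    IsLclm ![op f, op g] (op m) ↔ IsLcrm ![f, g] m := by
  have h : ∀ a b : R, RDvd (op a) (op b) ↔ LDvd a b := fun a b =>
    ⟨fun ⟨u, hu⟩ => ⟨unop u, congrArg unop hu⟩, fun ⟨u, hu⟩ => ⟨op u, congrArg op hu⟩⟩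
  simp [IsLclm, IsLcrm, Fin.forall_fin_two, h]

open MulOpposite in
theorem lCoprime_op_iff {R : Type*} [Ring R] {f g : R} :
    LCoprime (op f) (op g) ↔ RCoprime f g := by
  simp only [LCoprime, RCoprime, op_surjective.exists, ← op_mul, ← op_add, op_eq_one_iff]

/-- For nonzero Ore polynomials with `f' * f = g' * g`, the product `f' * f` is a
least common left multiple of `f` and `g` iff `gcld (f', g') = 1`; dually, if
`f * f' = g * g'`, then `f * f'` is a least common right multiple of `f` and `g`
iff `gcrd (f', g') = 1`. -/
theorem lclm_iff_gcld_one
    {L : Type*} [Field L] (σ : L ≃+* L) (δ : L → L) (hδ : IsSigmaDerivation σ δ)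
    {R : Type*} [Ring R] (C : L →+* R) (X : R) (H : IsOreExtension σ δ R C X)
    (f g f' g' : R) (hf : f ≠ 0) (hg : g ≠ 0) (hf' : f' ≠ 0) (hg' : g' ≠ 0) :
    (f' * f = g' * g → (IsLclm ![f, g] (f' * f) ↔ LCoprime f' g')) ∧
    (f * f' = g * g' → (IsLcrm ![f, g] (f * f') ↔ RCoprime f' g')) := by
  have := H.noZeroDivisors hδ
  have : Nontrivial R := ⟨f, 0, hf⟩
  have : IsDomain R := NoZeroDivisors.to_isDomain R
  have : IsPrincipalIdealRing R := isPrincipalIdealRing_of_exists_sub_mul_lt H.natDeg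
    fun r _ hg => H.exists_sub_mul_natDeg_lt hδ r hg
  have : IsPrincipalIdealRing Rᵐᵒᵖ :=
    isPrincipalIdealRing_of_exists_sub_mul_lt (fun r => H.natDeg r.unop) fun r g hg => by
      obtain ⟨q, hq⟩ := H.exists_sub_mul_natDeg_lt' hδ r.unop
        ((MulOpposite.unop_ne_zero_iff g).mpr hg)
      exact ⟨.op q, hq.imp_left fun h => MulOpposite.unop_injective h⟩
  have : IsPrincipalIdealRing Rᵐᵒᵖᵐᵒᵖ :=
    .of_surjective (RingEquiv.opOp R).toRingHom (RingEquiv.opOp R).surjective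
  refine ⟨isLclm_iff_lCoprime hf hf', fun h => ?_⟩
  rw [← isLclm_op_iff, ← lCoprime_op_iff, MulOpposite.op_mul]
  exact isLclm_iff_lCoprime ((MulOpposite.op_ne_zero_iff f).mpr hf)
    ((MulOpposite.op_ne_zero_iff f').mpr hf') (congrArg MulOpposite.op h)
end

section
/- Under the P-independence hypothesis, for every 0 ≤ k ≤ n−1, the linear polynomial x − α_k is a right divisor of the error locator λ if and only if k ∈ {k_1, …, k_ν}, i.e. if and only if k is an error position. -/
section OreExtension

variable {L : Type*} [Field L] {σ : L ≃+* L} {δ : L → L} {R : Type*} [Ring R]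
  {C : L →+* R} {X : R}

theorem RDvd.trans {f g h : R} (hfg : RDvd f g) (hgh : RDvd g h) : RDvd f h := by
  obtain ⟨u, rfl⟩ := hfg
  obtain ⟨v, rfl⟩ := hgh
  exact ⟨v * u, (mul_assoc _ _ _).symm⟩

/-- The product of the linear polynomials `X - C b`, for `b` running through a list. -/
def linearProd (C : L →+* R) (X : R) (l : List L) : R :=
  (l.map fun b => X - C b).prod

@[simp]
theorem linearProd_nil : linearProd C X [] = 1 := rfl

@[simp]
theorem linearProd_cons (b : L) (l : List L) :
    linearProd C X (b :: l) = (X - C b) * linearProd C X l := by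
  simp [linearProd]

theorem rdvd_linearProd_append (l' l : List L) :
    RDvd (linearProd C X l) (linearProd C X (l' ++ l)) :=
  ⟨linearProd C X l', by simp [linearProd]⟩

theorem linearProd_eq_mul_add (H : IsOreExtension σ δ R C X) (a : L) (l : List L) :
    ∃ (q : R) (r : L), linearProd C X l = q * (X - C a) + C r := by
  induction l with
  | nil => exact ⟨0, 1, by simp⟩
  | cons b l ih =>
    obtain ⟨q, r, h⟩ := ih
    refine ⟨(X - C b) * q + C (σ r), σ r * a + δ r - b * r, ?_⟩
    rw [linearProd_cons, h, mul_add, sub_mul X (C b) (C r), H.twist]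
    simp only [map_sub, map_add, map_mul]
    noncomm_ring

/-- A product of linear polynomials is made right divisible by `X - C a` by at most one
further linear factor on the left. -/
theorem exists_rdvd_linearProd_append_singleton (H : IsOreExtension σ δ R C X) (a : L)
    (l : List L) :
    ∃ l' : List L, l'.length ≤ 1 ∧ RDvd (X - C a) (linearProd C X (l' ++ l)) := by
  obtain ⟨q, r, h⟩ := linearProd_eq_mul_add H a l
  by_cases hr : r = 0
  · exact ⟨[], by simp, q, by simpa [hr] using h⟩
  · refine ⟨[(δ r + σ r * a) / r], by simp, (X - C ((δ r + σ r * a) / r)) * q + C (σ r), ?_⟩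
    have hb : C ((δ r + σ r * a) / r) * C r = C (δ r) + C (σ r) * C a := by
      rw [← map_mul, div_mul_cancel₀ _ hr, map_add, map_mul]
    rw [List.singleton_append, linearProd_cons, h, mul_add, sub_mul X _ (C r), H.twist, hb]
    noncomm_ring

theorem exists_rdvd_linearProd_append (H : IsOreExtension σ δ R C X) (T : Finset L)
    (l : List L) :
    ∃ l' : List L, l'.length ≤ T.card ∧
      ∀ a ∈ T, RDvd (X - C a) (linearProd C X (l' ++ l)) := by
  classical
  induction T using Finset.induction_on with
  | empty => exact ⟨[], by simp⟩
  | insert a T ha ih =>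
    obtain ⟨l₁, hlen₁, h₁⟩ := ih
    obtain ⟨l₂, hlen₂, h₂⟩ := exists_rdvd_linearProd_append_singleton H a (l₁ ++ l)
    refine ⟨l₂ ++ l₁, ?_, ?_⟩
    · rw [List.length_append, Finset.card_insert_of_notMem ha]
      omega
    · intro b hb
      rw [List.append_assoc]
      rcases Finset.mem_insert.mp hb with rfl | hb
      · exact h₂
      · exact (h₁ b hb).trans (rdvd_linearProd_append _ _)

/-- The additive group of Ore polynomials of degree less than `d`. -/
def oreDegreeLT (C : L →+* R) (X : R) (d : ℕ) : AddSubgroup R :=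
  AddSubgroup.closure {r | ∃ (a : L) (i : ℕ), i < d ∧ r = C a * X ^ i}

theorem monomial_mem_oreDegreeLT (a : L) {i d : ℕ} (h : i < d) :
    C a * X ^ i ∈ oreDegreeLT C X d :=
  AddSubgroup.subset_closure ⟨a, i, h, rfl⟩

theorem oreDegreeLT_mono {d d' : ℕ} (h : d ≤ d') :
    oreDegreeLT C X d ≤ oreDegreeLT C X d' :=
  AddSubgroup.closure_mono fun _ ⟨a, i, hi, hr⟩ => ⟨a, i, hi.trans_le h, hr⟩

theorem C_mul_mem_oreDegreeLT (b : L) {d : ℕ} {r : R} (hr : r ∈ oreDegreeLT C X d) :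
    C b * r ∈ oreDegreeLT C X d := by
  induction hr using AddSubgroup.closure_induction with
  | mem r h =>
    obtain ⟨a, i, hi, rfl⟩ := h
    rw [← mul_assoc, ← map_mul]
    exact monomial_mem_oreDegreeLT _ hi
  | zero => simp
  | add x y _ _ hx hy => rw [mul_add]; exact add_mem hx hy
  | neg x _ hx => rw [mul_neg]; exact neg_mem hx

theorem X_mul_monomial (H : IsOreExtension σ δ R C X) (a : L) (i : ℕ) :
    X * (C a * X ^ i) = C (σ a) * X ^ (i + 1) + C (δ a) * X ^ i := by
  rw [← mul_assoc, H.twist, add_mul, mul_assoc, pow_succ']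

theorem X_mul_mem_oreDegreeLT (H : IsOreExtension σ δ R C X) {d : ℕ} {r : R}
    (hr : r ∈ oreDegreeLT C X d) : X * r ∈ oreDegreeLT C X (d + 1) := by
  induction hr using AddSubgroup.closure_induction with
  | mem r h =>
    obtain ⟨a, i, hi, rfl⟩ := h
    rw [X_mul_monomial H]
    exact add_mem (monomial_mem_oreDegreeLT _ (by omega)) (monomial_mem_oreDegreeLT _ (by omega))
  | zero => simp
  | add x y _ _ hx hy => rw [mul_add]; exact add_mem hx hy
  | neg x _ hx => rw [mul_neg]; exact neg_mem hx

/-- `r` is an Ore polynomial of degree exactly `d`. -/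
def HasOreDegree (C : L →+* R) (X : R) (d : ℕ) (r : R) : Prop :=
  ∃ c : L, c ≠ 0 ∧ r - C c * X ^ d ∈ oreDegreeLT C X d

namespace HasOreDegree

variable {d : ℕ} {r : R}

theorem mem_oreDegreeLT (h : HasOreDegree C X d r) : r ∈ oreDegreeLT C X (d + 1) := by
  obtain ⟨c, -, h⟩ := h
  rw [← sub_add_cancel r (C c * X ^ d)]
  exact add_mem (oreDegreeLT_mono d.le_succ h) (monomial_mem_oreDegreeLT _ d.lt_succ_self)

theorem add_of_mem (h : HasOreDegree C X d r) {s : R} (hs : s ∈ oreDegreeLT C X d) :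
    HasOreDegree C X d (r + s) := by
  obtain ⟨c, hc, h⟩ := h
  refine ⟨c, hc, ?_⟩
  rw [add_sub_right_comm]
  exact add_mem h hs

theorem C_mul (h : HasOreDegree C X d r) {b : L} (hb : b ≠ 0) :
    HasOreDegree C X d (C b * r) := by
  obtain ⟨c, hc, h⟩ := h
  refine ⟨b * c, mul_ne_zero hb hc, ?_⟩
  rw [map_mul, mul_assoc, ← mul_sub]
  exact C_mul_mem_oreDegreeLT b h

theorem X_mul (H : IsOreExtension σ δ R C X) (h : HasOreDegree C X d r) :
    HasOreDegree C X (d + 1) (X * r) := by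
  obtain ⟨c, hc, h⟩ := h
  refine ⟨σ c, by simpa using hc, ?_⟩
  have key : X * r - C (σ c) * X ^ (d + 1) = X * (r - C c * X ^ d) + C (δ c) * X ^ d := by
    rw [mul_sub, X_mul_monomial H]
    abel
  rw [key]
  exact add_mem (X_mul_mem_oreDegreeLT H h) (monomial_mem_oreDegreeLT _ d.lt_succ_self)

theorem X_pow_mul (H : IsOreExtension σ δ R C X) (h : HasOreDegree C X d r) (j : ℕ) :
    HasOreDegree C X (j + d) (X ^ j * r) := by
  induction j with
  | zero => simpa using h
  | succ j ih =>
    rw [pow_succ', mul_assoc, Nat.add_right_comm]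
    exact ih.X_mul H

theorem mul_mem_oreDegreeLT (H : IsOreExtension σ δ R C X) (h : HasOreDegree C X d r)
    {j : ℕ} {u : R} (hu : u ∈ oreDegreeLT C X j) : u * r ∈ oreDegreeLT C X (j + d) := by
  induction hu using AddSubgroup.closure_induction with
  | mem u hu =>
    obtain ⟨a, i, hi, rfl⟩ := hu
    rw [mul_assoc]
    exact C_mul_mem_oreDegreeLT _
      (oreDegreeLT_mono (by omega) (h.X_pow_mul H i).mem_oreDegreeLT)
  | zero => simp
  | add x y _ _ hx hy => rw [add_mul]; exact add_mem hx hy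
  | neg x _ hx => rw [neg_mul]; exact neg_mem hx

theorem mul (H : IsOreExtension σ δ R C X) {j : ℕ} {u : R} (hu : HasOreDegree C X j u)
    (h : HasOreDegree C X d r) : HasOreDegree C X (j + d) (u * r) := by
  obtain ⟨c, hc, hu⟩ := hu
  rw [← add_sub_cancel (C c * X ^ j) u, add_mul, mul_assoc]
  exact ((h.X_pow_mul H j).C_mul hc).add_of_mem (h.mul_mem_oreDegreeLT H hu)

theorem linearProd (H : IsOreExtension σ δ R C X) (l : List L) :
    HasOreDegree C X l.length (linearProd C X l) := by
  induction l with
  | nil => exact ⟨1, one_ne_zero, by simp⟩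
  | cons b l ih =>
    rw [linearProd_cons, sub_mul, sub_eq_add_neg]
    exact (ih.X_mul H).add_of_mem (neg_mem (C_mul_mem_oreDegreeLT b ih.mem_oreDegreeLT))

end HasOreDegree

theorem exists_sum_eq_of_mem_oreDegreeLT {d : ℕ} {r : R} (hr : r ∈ oreDegreeLT C X d) :
    ∃ f : ℕ →₀ L, r = f.sum (fun n a => C a * X ^ n) ∧ ∀ i, d ≤ i → f i = 0 := by
  induction hr using AddSubgroup.closure_induction with
  | mem r h =>
    obtain ⟨a, i, hi, rfl⟩ := h
    exact ⟨Finsupp.single i a, by simp, fun j hj => Finsupp.single_eq_of_ne (by omega)⟩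
  | zero => exact ⟨0, by simp⟩
  | add x y _ _ hx hy =>
    obtain ⟨f, rfl, hf⟩ := hx
    obtain ⟨g, rfl, hg⟩ := hy
    refine ⟨f + g, ?_, fun i hi => by simp [hf i hi, hg i hi]⟩
    rw [Finsupp.sum_add_index' (by simp) (by simp [add_mul])]
  | neg x _ hx =>
    obtain ⟨f, rfl, hf⟩ := hx
    refine ⟨-f, ?_, fun i hi => by simp [hf i hi]⟩
    rw [Finsupp.sum_neg_index (by simp)]
    simp [Finsupp.sum]

theorem HasOreDegree.exists_sum_eq {d : ℕ} {r : R} (h : HasOreDegree C X d r) :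
    ∃ f : ℕ →₀ L, r = f.sum (fun n a => C a * X ^ n) ∧ f d ≠ 0 ∧ ∀ i, d < i → f i = 0 := by
  obtain ⟨c, hc, h⟩ := h
  obtain ⟨f, hf, hd⟩ := exists_sum_eq_of_mem_oreDegreeLT h
  refine ⟨f + Finsupp.single d c, ?_, by simpa [hd d le_rfl] using hc, fun i hi => ?_⟩
  · rw [Finsupp.sum_add_index' (by simp) (by simp [add_mul]), ← hf]
    simp
  · rw [Finsupp.add_apply, hd i hi.le, Finsupp.single_eq_of_ne (by omega), add_zero]

theorem HasOreDegree.unique (H : IsOreExtension σ δ R C X) {d d' : ℕ} {r : R}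
    (h : HasOreDegree C X d r) (h' : HasOreDegree C X d' r) : d = d' := by
  obtain ⟨f, hf, hd, hlt⟩ := h.exists_sum_eq
  obtain ⟨f', hf', hd', hlt'⟩ := h'.exists_sum_eq
  obtain rfl := (H.repr_unique r).unique hf hf'
  exact le_antisymm (not_lt.mp fun hl => hd (hlt' _ hl)) (not_lt.mp fun hl => hd' (hlt _ hl))

theorem IsOreExtension.hasOreDegree (H : IsOreExtension σ δ R C X) {r : R} {d : ℕ}
    (h : H.deg r = d) : HasOreDegree C X d r := by
  set f := (H.repr_unique r).exists.choose with hf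
  have hr : r = f.sum fun n a => C a * X ^ n := (H.repr_unique r).exists.choose_spec
  have hmax : f.support.max = d := h
  have hd : d ∈ f.support := Finset.mem_of_max hmax
  refine ⟨f d, Finsupp.mem_support_iff.mp hd, ?_⟩
  have key : r - C (f d) * X ^ d = ∑ i ∈ f.support.erase d, C (f i) * X ^ i := by
    rw [sub_eq_iff_eq_add, Finset.sum_erase_add _ _ hd]
    exact hr
  rw [key]
  refine sum_mem fun i hi => monomial_mem_oreDegreeLT _ ?_
  obtain ⟨hne, hi⟩ := Finset.mem_erase.mp hi
  exact lt_of_le_of_ne (Finset.le_max_of_eq hi hmax) hne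

theorem IsOreExtension.exists_hasOreDegree (H : IsOreExtension σ δ R C X) {r : R}
    (h : r ≠ 0) : ∃ d, HasOreDegree C X d r := by
  have hne : (H.repr_unique r).exists.choose.support.Nonempty := by
    rw [Finsupp.support_nonempty_iff]
    intro h0
    have hr := (H.repr_unique r).exists.choose_spec
    rw [h0, Finsupp.sum_zero_index] at hr
    exact h hr
  exact ⟨_, H.hasOreDegree (Finset.coe_max' hne).symm⟩

theorem HasOreDegree.ne_zero (H : IsOreExtension σ δ R C X) {d : ℕ} {r : R}
    (h : HasOreDegree C X d r) : r ≠ 0 := by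
  rintro rfl
  have := (h.X_mul H)
  rw [mul_zero] at this
  exact absurd (this.unique H h) (by omega)

theorem HasOreDegree.le_of_rdvd (H : IsOreExtension σ δ R C X) {d d' : ℕ} {r s : R}
    (hr : HasOreDegree C X d r) (hs : HasOreDegree C X d' s) (h : RDvd r s) : d ≤ d' := by
  obtain ⟨u, rfl⟩ := h
  obtain ⟨j, hj⟩ := H.exists_hasOreDegree (left_ne_zero_of_mul (hs.ne_zero H))
  rw [hs.unique H (hj.mul H hr)]
  exact Nat.le_add_left _ _

end OreExtension

/-- Under the P-independence hypothesis on the positional points, the linear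
polynomial `x - α k` is a right divisor of the error locator `lam` if and only if
`k` is one of the error positions `k_1, …, k_ν`. -/
theorem locator_right_roots_are_error_positions
    {L : Type*} [Field L] (σ : L ≃+* L) (δ : L → L) (hδ : IsSigmaDerivation σ δ)
    {R : Type*} [Ring R] (C : L →+* R) (X : R) (H : IsOreExtension σ δ R C X)
    (F : Subfield L) (n : ℕ) (α : Fin n → L) (hα : Function.Injective α)
    (Pind : ∃ Λ : R, IsLclm (fun i : Fin n => X - C (α i)) Λ ∧ H.deg Λ = (n : WithBot ℕ))
    (e : Fin n → L) (heF : ∀ i, e i ∈ F)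
    (ν : ℕ) (k : Fin ν → Fin n) (hk : Function.Injective k)
    (hek : ∀ j, e (k j) ≠ 0) (hesupp : ∀ i, (∀ j, k j ≠ i) → e i = 0)
    (lam : R) (hlam : IsLclm (fun j : Fin ν => X - C (α (k j))) lam) :
    ∀ i : Fin n, RDvd (X - C (α i)) lam ↔ ∃ j, k j = i := by
  classical
  intro i
  refine ⟨fun hi => ?_, fun ⟨j, hj⟩ => hj ▸ hlam.1 j⟩
  by_contra! hik
  obtain ⟨Λ, hΛ, hdeg⟩ := Pind
  let K : Finset (Fin n) := Finset.univ.image k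
  have hiK : i ∉ K := by simpa [K] using hik
  obtain ⟨l, hl, hdvd⟩ := exists_rdvd_linearProd_append H (K.image α) []
  rw [List.append_nil] at hdvd
  have hlaml : RDvd lam (linearProd C X l) := hlam.2 _ fun j =>
    hdvd _ (Finset.mem_image_of_mem α (Finset.mem_image_of_mem k (Finset.mem_univ j)))
  obtain ⟨l', hl', hdvd'⟩ := exists_rdvd_linearProd_append H ((insert i K)ᶜ.image α) l
  have hΛl : RDvd Λ (linearProd C X (l' ++ l)) := by
    refine hΛ.2 _ fun m => ?_
    by_cases hm : m ∈ insert i K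
    · refine RDvd.trans ?_ (rdvd_linearProd_append l' l)
      rcases Finset.mem_insert.mp hm with rfl | hm
      · exact hi.trans hlaml
      · exact hdvd _ (Finset.mem_image_of_mem α hm)
    · exact hdvd' _ (Finset.mem_image_of_mem α (Finset.mem_compl.mpr hm))
  have hle := (H.hasOreDegree hdeg).le_of_rdvd H (HasOreDegree.linearProd H (l' ++ l)) hΛl
  have hcard := (insert i K).card_add_card_compl
  rw [Finset.card_insert_of_notMem hiK, Fintype.card_fin] at hcard
  have h₁ : (K.image α).card ≤ K.card := Finset.card_image_le
  have h₂ : ((insert i K)ᶜ.image α).card ≤ (insert i K)ᶜ.card := Finset.card_image_le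
  rw [List.length_append] at hle
  omega
end
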